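/- arXiv:1904.07918 — 3 statements merged into one kernel-verified Lean document; each statement's English description precedes it below -/
import Mathlib

section
/- Let Λ be an abelian group, R a Λ-graded ring, Λ' ⊆ Λ a subgroup, and M a Λ-graded R-module which is Noetherian as an R-module (in particular finitely generated; Noetherianity is the hypothesis needed to make the paper's proof work, and it holds in the paper's application to stalks of the sheaf C^log). Then M' = ⊕_{λ∈Λ'} M_λ is a finitely generated module over the subring R' = ⊕_{λ∈Λ'} R_λ. -/
/-- If `t` consists of homogeneous elements of degree in `Λ'` and `R'` contains all homogeneous
elements of degree in `Λ'`, then the components with degree in `Λ'` of any element of the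
`R`-span of `t` lie in the `R'`-span of `t`. -/
theorem decompose_mem_span_of_mem_span
    {Λ : Type*} [AddCommGroup Λ] [DecidableEq Λ]
    {R : Type*} [Ring R] (𝒜 : Λ → AddSubgroup R) [GradedRing 𝒜]
    {M : Type*} [AddCommGroup M] [Module R M]
    (ℳ : Λ → AddSubgroup M) [SetLike.GradedSMul 𝒜 ℳ] [DirectSum.Decomposition ℳ]
    {Λ' : AddSubgroup Λ} {R' : Subring R} (hR' : ∀ l ∈ Λ', ∀ r ∈ 𝒜 l, r ∈ R')
    {t : Set M} (ht : ∀ m ∈ t, ∃ l ∈ Λ', m ∈ ℳ l)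
    {x : M} (hx : x ∈ Submodule.span R t) {l : Λ} (hl : l ∈ Λ') :
    (DirectSum.decompose ℳ x l : M) ∈ Submodule.span R' t := by
  induction hx using Submodule.closure_induction with
  | zero => simp
  | add x y _ _ hx hy =>
    rw [DirectSum.decompose_add]
    exact add_mem hx hy
  | smul_mem r y hy =>
    obtain ⟨k, hk, hyk⟩ := ht y hy
    induction r using DirectSum.Decomposition.inductionOn 𝒜 with
    | zero => simp
    | add a b ha hb =>
      rw [add_smul, DirectSum.decompose_add]
      exact add_mem ha hb
    | @homogeneous i a =>
      have hmem : (a : R) • y ∈ ℳ (i + k) := SetLike.GradedSMul.smul_mem a.2 hyk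
      by_cases h : i + k = l
      · subst h
        rw [DirectSum.decompose_of_mem_same ℳ hmem]
        have hi : i ∈ Λ' := (add_mem_cancel_right hk).mp hl
        exact Submodule.smul_mem _ (⟨a, hR' i hi a a.2⟩ : R') (Submodule.subset_span hy)
      · rw [DirectSum.decompose_of_mem_ne ℳ hmem h]
        exact zero_mem _

/-- Let `Λ` be an abelian group, `R` a `Λ`-graded ring (grading `𝒜`), `M` a `Λ`-graded
`R`-module (grading `ℳ`) which is Noetherian as an `R`-module, and `Λ'` a subgroup of `Λ`.
Then `M' = ⊕_{λ ∈ Λ'} M_λ`, i.e. the `R'`-submodule of `M` generated by the homogeneous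
elements of `M` with degree in `Λ'`, is finitely generated over the subring
`R' = ⊕_{λ ∈ Λ'} R_λ` of `R` generated by the homogeneous elements with degree in `Λ'`. -/
theorem fg_of_grading_restriction
    {Λ : Type*} [AddCommGroup Λ] [DecidableEq Λ]
    {R : Type*} [Ring R] (𝒜 : Λ → AddSubgroup R) [GradedRing 𝒜]
    {M : Type*} [AddCommGroup M] [Module R M]
    (ℳ : Λ → AddSubgroup M) [SetLike.GradedSMul 𝒜 ℳ] [DirectSum.Decomposition ℳ]
    [IsNoetherian R M]
    (Λ' : AddSubgroup Λ)
    (R' : Subring R)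
    (hR' : R' = Subring.closure (⋃ l ∈ Λ', (𝒜 l : Set R))) :
    (Submodule.span R' {m : M | ∃ l ∈ Λ', m ∈ ℳ l}).FG := by
  have hmem : ∀ l ∈ Λ', ∀ r ∈ 𝒜 l, r ∈ R' := fun l hl r hr =>
    hR' ▸ Subring.subset_closure (Set.mem_biUnion hl hr)
  obtain ⟨t, ht, hspan⟩ := (Submodule.fg_span_iff_fg_span_finset_subset (R := R)
    {m : M | ∃ l ∈ Λ', m ∈ ℳ l}).mp (IsNoetherian.noetherian _)
  refine ⟨t, le_antisymm (Submodule.span_mono ht) (Submodule.span_le.mpr ?_)⟩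
  rintro m ⟨l, hl, hm⟩
  have hmt : m ∈ Submodule.span R (t : Set M) :=
    hspan ▸ Submodule.subset_span ⟨l, hl, hm⟩
  rw [← DirectSum.decompose_of_mem_same ℳ hm]
  exact decompose_mem_span_of_mem_span 𝒜 ℳ hmem ht hmt hl
end

section
/- For every subset S ⊆ M', the intersection of M' with the R-submodule of M generated by S equals the R'-submodule of M generated by S. (This is the mechanism behind the paper's proof that finite generation descends from M over R to M' over R': any element of M' that is an R-linear combination of elements of S is already an R'-linear combination of them, by applying the projection ψ.) -/
section DegreeProjection

variable {Λ : Type*} [AddCommGroup Λ] [DecidableEq Λ] {M : Type*} [AddCommGroup M]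
  (ℳ : Λ → AddSubgroup M) [DirectSum.Decomposition ℳ] (Λ' : AddSubgroup Λ)

open Classical in
/-- The additive projection annihilating the homogeneous components of degree outside `Λ'`. -/
noncomputable def degreeProjection : M →+ M :=
  (DirectSum.toAddMonoid fun l => if l ∈ Λ' then (ℳ l).subtype else 0).comp
    (DirectSum.decomposeAddEquiv ℳ).toAddMonoidHom

variable {ℳ Λ'}

theorem degreeProjection_of_mem {l : Λ} (hl : l ∈ Λ') {m : M} (hm : m ∈ ℳ l) :
    degreeProjection ℳ Λ' m = m := by
  simp [degreeProjection, DirectSum.decompose_of_mem ℳ hm, hl]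

theorem degreeProjection_of_notMem {l : Λ} (hl : l ∉ Λ') {m : M} (hm : m ∈ ℳ l) :
    degreeProjection ℳ Λ' m = 0 := by
  simp [degreeProjection, DirectSum.decompose_of_mem ℳ hm, hl]

theorem decompose_degreeProjection_of_notMem {l : Λ} (hl : l ∉ Λ') (m : M) :
    (DirectSum.decompose ℳ (degreeProjection ℳ Λ' m) l : M) = 0 := by
  induction m using DirectSum.Decomposition.inductionOn ℳ with
  | zero => simp
  | @homogeneous i m =>
    by_cases hi : i ∈ Λ'
    · rw [degreeProjection_of_mem hi m.2]
      exact DirectSum.decompose_of_mem_ne ℳ m.2 fun h => hl (h ▸ hi)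
    · simp [degreeProjection_of_notMem hi m.2]
  | add m n hm hn => simp [DirectSum.decompose_add, hm, hn]

theorem degreeProjection_eq_self_iff {m : M} :
    degreeProjection ℳ Λ' m = m ↔
      ∀ l : Λ, (DirectSum.decompose ℳ m l : M) ≠ 0 → l ∈ Λ' := by
  classical
  refine ⟨fun h l hl => ?_, fun h => ?_⟩
  · by_contra hl'
    exact hl (h ▸ decompose_degreeProjection_of_notMem hl' m)
  · conv_lhs => rw [← DirectSum.sum_support_decompose ℳ m]
    conv_rhs => rw [← DirectSum.sum_support_decompose ℳ m]
    rw [map_sum]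
    refine Finset.sum_congr rfl fun l hl => degreeProjection_of_mem (h l ?_) (SetLike.coe_mem _)
    simpa using hl

variable {R : Type*} [Ring R] {𝒜 : Λ → AddSubgroup R} [Module R M] [SetLike.GradedSMul 𝒜 ℳ]

theorem degreeProjection_smul_of_mem {l : Λ} (hl : l ∈ Λ') {r : R} (hr : r ∈ 𝒜 l) (m : M) :
    degreeProjection ℳ Λ' (r • m) = r • degreeProjection ℳ Λ' m := by
  induction m using DirectSum.Decomposition.inductionOn ℳ with
  | zero => simp
  | @homogeneous i m =>
    have hrm : r • (m : M) ∈ ℳ (l + i) := SetLike.GradedSMul.smul_mem hr m.2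
    by_cases hi : i ∈ Λ'
    · rw [degreeProjection_of_mem hi m.2, degreeProjection_of_mem (Λ'.add_mem hl hi) hrm]
    · rw [degreeProjection_of_notMem hi m.2, smul_zero,
        degreeProjection_of_notMem (fun h => hi ((Λ'.add_mem_cancel_left hl).1 h)) hrm]
  | add m n hm hn => simp [smul_add, hm, hn]

theorem degreeProjection_smul_degreeProjection_of_notMem {l : Λ} (hl : l ∉ Λ') {r : R}
    (hr : r ∈ 𝒜 l) (m : M) :
    degreeProjection ℳ Λ' (r • degreeProjection ℳ Λ' m) = 0 := by
  induction m using DirectSum.Decomposition.inductionOn ℳ with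
  | zero => simp
  | @homogeneous i m =>
    have hrm : r • (m : M) ∈ ℳ (l + i) := SetLike.GradedSMul.smul_mem hr m.2
    by_cases hi : i ∈ Λ'
    · rw [degreeProjection_of_mem hi m.2,
        degreeProjection_of_notMem (fun h => hl ((Λ'.add_mem_cancel_right hi).1 h)) hrm]
    · simp [degreeProjection_of_notMem hi m.2]
  | add m n hm hn => simp [smul_add, hm, hn]

theorem degreeProjection_smul_of_mem_closure {r : R}
    (hr : r ∈ Subring.closure (⋃ l ∈ Λ', (𝒜 l : Set R))) (m : M) :
    degreeProjection ℳ Λ' (r • m) = r • degreeProjection ℳ Λ' m := by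
  induction hr using Subring.closure_induction generalizing m with
  | mem r hr =>
    simp only [Set.mem_iUnion] at hr
    obtain ⟨l, hl, hr⟩ := hr
    exact degreeProjection_smul_of_mem hl hr m
  | zero => simp
  | one => simp
  | add r s _ _ hr hs => simp [add_smul, hr, hs]
  | neg r _ hr => simp [hr]
  | mul r s _ _ hr hs => simp [mul_smul, hr, hs]

variable (ℳ Λ') in
theorem exists_mem_closure_degreeProjection_smul [GradedRing 𝒜] (r : R) :
    ∃ s ∈ Subring.closure (⋃ l ∈ Λ', (𝒜 l : Set R)), ∀ m : M,
      degreeProjection ℳ Λ' (r • degreeProjection ℳ Λ' m) = s • degreeProjection ℳ Λ' m := by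
  induction r using DirectSum.Decomposition.inductionOn 𝒜 with
  | zero => exact ⟨0, zero_mem _, by simp⟩
  | @homogeneous l r =>
    by_cases hl : l ∈ Λ'
    · refine ⟨r, Subring.subset_closure (Set.mem_biUnion hl r.2), fun m => ?_⟩
      rw [degreeProjection_smul_of_mem hl r.2,
        degreeProjection_eq_self_iff.2 fun i hi => ?_]
      by_contra hi'
      exact hi (decompose_degreeProjection_of_notMem hi' m)
    · exact ⟨0, zero_mem _, fun m => by
        rw [degreeProjection_smul_degreeProjection_of_notMem hl r.2, zero_smul]⟩
  | add r₁ r₂ h₁ h₂ =>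
    obtain ⟨s₁, hs₁, h₁⟩ := h₁
    obtain ⟨s₂, hs₂, h₂⟩ := h₂
    exact ⟨s₁ + s₂, add_mem hs₁ hs₂, fun m => by simp [add_smul, h₁, h₂]⟩

end DegreeProjection

/-- Let `Λ` be an abelian group, `R` a `Λ`-graded ring (grading `𝒜`), `M` a `Λ`-graded
`R`-module (grading `ℳ`), `Λ'` a subgroup of `Λ`, `R' = ⊕_{λ∈Λ'} R_λ` the subring of `R`
generated by the homogeneous elements with degree in `Λ'`, and
`M' = {m : M | all nonzero homogeneous components of m have degree in Λ'}`.
Then for every subset `S ⊆ M'`, the intersection of `M'` with the `R`-submodule of `M`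
generated by `S` equals the `R'`-submodule of `M` generated by `S`. -/
theorem span_inter_of_grading_restriction
    {Λ : Type*} [AddCommGroup Λ] [DecidableEq Λ]
    {R : Type*} [Ring R] (𝒜 : Λ → AddSubgroup R) [GradedRing 𝒜]
    {M : Type*} [AddCommGroup M] [Module R M]
    (ℳ : Λ → AddSubgroup M) [SetLike.GradedSMul 𝒜 ℳ] [DirectSum.Decomposition ℳ]
    (Λ' : AddSubgroup Λ)
    (R' : Subring R)
    (hR' : R' = Subring.closure (⋃ l ∈ Λ', (𝒜 l : Set R)))
    (M' : Set M)
    (hM' : M' = {m : M | ∀ l : Λ, (DirectSum.decompose ℳ m l : M) ≠ 0 → l ∈ Λ'})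
    (S : Set M) (hS : S ⊆ M') :
    (Submodule.span R S : Set M) ∩ M' = (Submodule.span R' S : Set M) := by
  subst hR' hM'
  have hfix : ∀ x ∈ S, degreeProjection ℳ Λ' x = x := fun x hx =>
    degreeProjection_eq_self_iff.2 (hS hx)
  refine Set.Subset.antisymm ?_ fun x hx => ⟨?_, ?_⟩
  · rintro x ⟨hx, hxM⟩
    have key : ∀ r : R, degreeProjection ℳ Λ' (r • x) ∈
        Submodule.span (Subring.closure (⋃ l ∈ Λ', (𝒜 l : Set R))) S := by
      clear hxM
      induction hx using Submodule.span_induction with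
      | mem x hx =>
        intro r
        obtain ⟨s, hs, h⟩ := exists_mem_closure_degreeProjection_smul (𝒜 := 𝒜) ℳ Λ' r
        have h := h x
        rw [hfix x hx] at h
        rw [h]
        exact Submodule.smul_mem _ (⟨s, hs⟩ : Subring.closure _) (Submodule.subset_span hx)
      | zero => simp
      | add x y _ _ hx hy =>
        intro r
        rw [smul_add, map_add]
        exact add_mem (hx r) (hy r)
      | smul a x _ hx =>
        intro r
        rw [← mul_smul]
        exact hx (r * a)
    have h := key 1
    rwa [one_smul, degreeProjection_eq_self_iff.2 hxM] at h
  · exact Submodule.span_subset_span _ R S hx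
  · refine degreeProjection_eq_self_iff.1 ?_
    induction hx using Submodule.span_induction with
    | mem x hx => exact hfix x hx
    | zero => simp
    | add x y _ _ hx hy => rw [map_add, hx, hy]
    | smul a x _ hx =>
      rw [Subring.smul_def, degreeProjection_smul_of_mem_closure a.2, hx]
end

section
/- Let M₁, M₂, M₃ be ℤ-graded R-modules and let f : M₁ → M₂ and g : M₂ → M₃ be degree-preserving R-linear maps (f(M₁ⁿ) ⊆ M₂ⁿ and g(M₂ⁿ) ⊆ M₃ⁿ for all n) with g ∘ f = 0. Write H = (ker g)/(im f), let f̄ : M₁/(z−1)M₁ → M₂/(z−1)M₂ and ḡ : M₂/(z−1)M₂ → M₃/(z−1)M₃ be the induced maps, and H̄ = (ker ḡ)/(im f̄). Then the map ker g → H̄ induced by the quotient map M₂ → M₂/(z−1)M₂ is surjective with kernel im f + (z−1)·(ker g); equivalently, reduction modulo (z−1) induces an isomorphism H/(z−1)H ≅ H̄. (This is the paper's claim that for any complex N of graded modules over a Rees ring one has Hⁱ(N/(z−1)N) ≅ Hⁱ(N)/(z−1)Hⁱ(N), in the middle-cohomology formulation.) -/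
section GradedModule

variable {R : Type*} [Ring R] {𝒜 : ℤ → AddSubgroup R} {z : R}
  {M : Type*} [AddCommGroup M] [Module R M]

/-- A degree-one scalar raises degrees by one. -/
theorem smul_mem_graded_add_one (hz : z ∈ 𝒜 1) (ℳ : ℤ → AddSubgroup M)
    [SetLike.GradedSMul 𝒜 ℳ] {j : ℤ} {m : M} (hm : m ∈ ℳ j) : z • m ∈ ℳ (j + 1) := by
  have h : z • m ∈ ℳ ((1 : ℤ) +ᵥ j) := SetLike.GradedSMul.smul_mem hz hm
  rwa [vadd_eq_add, add_comm] at h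

theorem pow_smul_mem_graded_add (hz : z ∈ 𝒜 1) (ℳ : ℤ → AddSubgroup M)
    [SetLike.GradedSMul 𝒜 ℳ] {j : ℤ} {m : M} (hm : m ∈ ℳ j) (k : ℕ) :
    z ^ k • m ∈ ℳ (j + k) := by
  induction k with
  | zero => simpa using hm
  | succ k ih =>
    rw [pow_succ', mul_smul, Nat.cast_succ, ← add_assoc]
    exact smul_mem_graded_add_one hz ℳ ih

theorem decompose_smul_add_one (hz : z ∈ 𝒜 1) (ℳ : ℤ → AddSubgroup M)
    [SetLike.GradedSMul 𝒜 ℳ] [DirectSum.Decomposition ℳ] (w : M) (i : ℤ) :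
    (DirectSum.decompose ℳ (z • w) (i + 1) : M) = z • (DirectSum.decompose ℳ w i : M) := by
  induction w using DirectSum.Decomposition.inductionOn ℳ with
  | zero => simp
  | @homogeneous j m =>
    by_cases hij : j = i
    · subst hij
      rw [DirectSum.decompose_of_mem_same ℳ (smul_mem_graded_add_one hz ℳ m.2),
        DirectSum.decompose_of_mem_same ℳ m.2]
    · rw [DirectSum.decompose_of_mem_ne ℳ (smul_mem_graded_add_one hz ℳ m.2) (by omega),
        DirectSum.decompose_of_mem_ne ℳ m.2 hij, smul_zero]
  | add a b ha hb => simp [smul_add, DirectSum.decompose_add, ha, hb]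

theorem exists_decompose_eq_zero (ℳ : ℤ → AddSubgroup M) [DirectSum.Decomposition ℳ] (w : M) :
    ∃ B : ℤ, ∀ i, B ≤ |i| → (DirectSum.decompose ℳ w i : M) = 0 := by
  induction w using DirectSum.Decomposition.inductionOn ℳ with
  | zero => exact ⟨0, by simp⟩
  | @homogeneous j m =>
    refine ⟨|j| + 1, fun i hi => DirectSum.decompose_of_mem_ne ℳ m.2 ?_⟩
    rintro rfl
    omega
  | add a b ha hb =>
    obtain ⟨A, hA⟩ := ha
    obtain ⟨B, hB⟩ := hb
    refine ⟨max A B, fun i hi => ?_⟩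
    simp [DirectSum.decompose_add, hA i (le_of_max_le_left hi), hB i (le_of_max_le_right hi)]

/-- If `(z - 1) w` is homogeneous of degree `N`, then `w` lives in degrees at least `N`. -/
theorem decompose_eq_zero_of_smul_sub_mem (hz : z ∈ 𝒜 1) (ℳ : ℤ → AddSubgroup M)
    [SetLike.GradedSMul 𝒜 ℳ] [DirectSum.Decomposition ℳ] {N : ℤ} {w : M}
    (hw : z • w - w ∈ ℳ N) {i : ℤ} (hi : i < N) : (DirectSum.decompose ℳ w i : M) = 0 := by
  obtain ⟨B, hB⟩ := exists_decompose_eq_zero ℳ w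
  have key : ∀ k : ℕ, -|B| + k < N → (DirectSum.decompose ℳ w (-|B| + k) : M) = 0 := by
    intro k
    induction k with
    | zero =>
      intro _
      apply hB
      simpa using le_abs_self B
    | succ k ih =>
      intro hk
      push_cast at hk ⊢
      have h := DirectSum.decompose_of_mem_ne ℳ hw (j := -|B| + k + 1) (by omega)
      rw [DirectSum.decompose_sub, DirectSum.sub_apply, AddSubgroup.coe_sub,
        decompose_smul_add_one hz, ih (by omega), smul_zero, zero_sub, neg_eq_zero] at h
      rwa [← add_assoc]
  by_cases hiB : i ≤ -|B|
  · refine hB i ?_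
    have := le_abs_self B
    have := neg_le_abs i
    omega
  · have h := key (i + |B|).toNat
    rw [Int.toNat_of_nonneg (by omega), show -|B| + (i + |B|) = i by ring] at h
    exact h hi

/-- Multiplication by `z - 1` is injective on a graded module. -/
theorem eq_zero_of_smul_sub_eq_zero (hz : z ∈ 𝒜 1) (ℳ : ℤ → AddSubgroup M)
    [SetLike.GradedSMul 𝒜 ℳ] [DirectSum.Decomposition ℳ] {w : M}
    (hw : z • w - w = 0) : w = 0 := by
  apply (DirectSum.decompose ℳ).injective
  ext i
  rw [decompose_eq_zero_of_smul_sub_mem hz ℳ (N := i + 1) (hw ▸ zero_mem _) (lt_add_one i)]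
  simp

/-- A homogeneous multiple of `z - 1` is killed by a power of `z`. -/
theorem exists_pow_smul_smul_sub_eq_zero (hz : z ∈ 𝒜 1) (ℳ : ℤ → AddSubgroup M)
    [SetLike.GradedSMul 𝒜 ℳ] [DirectSum.Decomposition ℳ] {N : ℤ} {w : M}
    (hw : z • w - w ∈ ℳ N) : ∃ k : ℕ, z ^ k • (z • w - w) = 0 := by
  have key : ∀ k : ℕ, (DirectSum.decompose ℳ w (N + k) : M) = -(z ^ k • (z • w - w)) := by
    intro k
    induction k with
    | zero =>
      have h := DirectSum.decompose_of_mem_same ℳ hw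
      have h' := decompose_smul_add_one hz ℳ w (N - 1)
      rw [decompose_eq_zero_of_smul_sub_mem hz ℳ hw (sub_one_lt N), smul_zero,
        sub_add_cancel] at h'
      rw [DirectSum.decompose_sub, DirectSum.sub_apply, AddSubgroup.coe_sub, h', zero_sub] at h
      rw [Nat.cast_zero, add_zero, pow_zero, one_smul, ← h, neg_neg]
    | succ k ih =>
      have h := DirectSum.decompose_of_mem_ne ℳ hw (j := N + k + 1) (by omega)
      rw [DirectSum.decompose_sub, DirectSum.sub_apply, AddSubgroup.coe_sub,
        decompose_smul_add_one hz, ih, sub_eq_zero] at h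
      rw [Nat.cast_succ, ← add_assoc, ← h, smul_neg, pow_succ', mul_smul]
  obtain ⟨B, hB⟩ := exists_decompose_eq_zero ℳ w
  refine ⟨(B - N).toNat, neg_eq_zero.mp ?_⟩
  rw [← key]
  apply hB
  have := Int.self_le_toNat (B - N)
  have := le_abs_self (N + ((B - N).toNat : ℤ))
  omega

theorem exists_pow_smul_sub_eq (z : R) (m : M) (k : ℕ) : ∃ w : M, z ^ k • m - m = z • w - w := by
  induction k with
  | zero => exact ⟨0, by simp⟩
  | succ k ih =>
    obtain ⟨w, hw⟩ := ih
    refine ⟨z ^ k • m + w, ?_⟩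
    rw [pow_succ', mul_smul, smul_add, ← sub_add_sub_cancel _ (z ^ k • m), hw]
    abel

/-- Modulo `z - 1`, every element is homogeneous of any sufficiently large degree. -/
theorem exists_mem_graded_sub_eq (hz : z ∈ 𝒜 1) (ℳ : ℤ → AddSubgroup M)
    [SetLike.GradedSMul 𝒜 ℳ] [DirectSum.Decomposition ℳ] (m : M) :
    ∃ B : ℤ, ∀ N, B ≤ N → ∃ h ∈ ℳ N, ∃ w : M, h - m = z • w - w := by
  induction m using DirectSum.Decomposition.inductionOn ℳ with
  | zero => exact ⟨0, fun N _ => ⟨0, zero_mem _, 0, by simp⟩⟩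
  | @homogeneous j m =>
    refine ⟨j, fun N hN => ⟨z ^ (N - j).toNat • (m : M), ?_, exists_pow_smul_sub_eq z _ _⟩⟩
    have h := pow_smul_mem_graded_add hz ℳ m.2 (N - j).toNat
    rwa [Int.toNat_of_nonneg (by omega), add_sub_cancel] at h
  | add a b ha hb =>
    obtain ⟨A, hA⟩ := ha
    obtain ⟨B, hB⟩ := hb
    refine ⟨max A B, fun N hN => ?_⟩
    obtain ⟨h, hh, w, hw⟩ := hA N (le_of_max_le_left hN)
    obtain ⟨h', hh', w', hw'⟩ := hB N (le_of_max_le_right hN)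
    refine ⟨h + h', add_mem hh hh', w + w', ?_⟩
    rw [add_sub_add_comm, hw, hw', smul_add]
    abel

end GradedModule


/-- Let `R` be a `ℤ`-graded ring, `z ∈ R₁`, and `M₁, M₂, M₃` `ℤ`-graded `R`-modules with
degree-preserving `R`-linear maps `f : M₁ → M₂`, `g : M₂ → M₃` satisfying `g ∘ f = 0`.
Let `Dᵢ : m ↦ z • m - m` be "multiplication by `z - 1`", so that `Mᵢ/(z-1)Mᵢ` is the
quotient by `Dᵢ.range`, and let `f̄, ḡ` be the induced maps on these quotients.
Then the map `ker g → H̄ = ker ḡ / im f̄` induced by the quotient map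
`M₂ → M₂/(z-1)M₂` is surjective with kernel `im f + (z-1)·(ker g)`; equivalently,
reduction mod `(z-1)` induces an isomorphism `H/(z-1)H ≅ H̄` on middle cohomology. -/
theorem middle_cohomology_mod_z_sub_one
    {R : Type*} [Ring R] (𝒜 : ℤ → AddSubgroup R) [GradedRing 𝒜]
    (z : R) (hz : z ∈ 𝒜 1)
    {M₁ M₂ M₃ : Type*}
    [AddCommGroup M₁] [Module R M₁] [AddCommGroup M₂] [Module R M₂]
    [AddCommGroup M₃] [Module R M₃]
    (ℳ₁ : ℤ → AddSubgroup M₁) [SetLike.GradedSMul 𝒜 ℳ₁] [DirectSum.Decomposition ℳ₁]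
    (ℳ₂ : ℤ → AddSubgroup M₂) [SetLike.GradedSMul 𝒜 ℳ₂] [DirectSum.Decomposition ℳ₂]
    (ℳ₃ : ℤ → AddSubgroup M₃) [SetLike.GradedSMul 𝒜 ℳ₃] [DirectSum.Decomposition ℳ₃]
    (f : M₁ →ₗ[R] M₂) (g : M₂ →ₗ[R] M₃)
    (hf_deg : ∀ n : ℤ, ∀ m ∈ ℳ₁ n, f m ∈ ℳ₂ n)
    (hg_deg : ∀ n : ℤ, ∀ m ∈ ℳ₂ n, g m ∈ ℳ₃ n)
    (hgf : ∀ m : M₁, g (f m) = 0)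
    -- multiplication by `z - 1` on each module
    (D₁ : M₁ →+ M₁) (hD₁ : ∀ m, D₁ m = z • m - m)
    (D₂ : M₂ →+ M₂) (hD₂ : ∀ m, D₂ m = z • m - m)
    (D₃ : M₃ →+ M₃) (hD₃ : ∀ m, D₃ m = z • m - m)
    -- the maps induced by `f` and `g` on the quotients `Mᵢ/(z-1)Mᵢ`
    (fbar : M₁ ⧸ D₁.range →+ M₂ ⧸ D₂.range)
    (hfbar : ∀ m : M₁, fbar (QuotientAddGroup.mk' D₁.range m) =
      QuotientAddGroup.mk' D₂.range (f m))
    (gbar : M₂ ⧸ D₂.range →+ M₃ ⧸ D₃.range)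
    (hgbar : ∀ m : M₂, gbar (QuotientAddGroup.mk' D₂.range m) =
      QuotientAddGroup.mk' D₃.range (g m)) :
    -- surjectivity: every class in `ker ḡ` is, modulo `im f̄`, the class of some `x ∈ ker g`
    (∀ y : M₂ ⧸ D₂.range, gbar y = 0 →
      ∃ x : M₂, g x = 0 ∧ y - QuotientAddGroup.mk' D₂.range x ∈ fbar.range) ∧
    -- kernel: an `x ∈ ker g` maps into `im f̄` iff `x ∈ im f + (z-1)·(ker g)`
    (∀ x : M₂, g x = 0 →
      (QuotientAddGroup.mk' D₂.range x ∈ fbar.range ↔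
        x ∈ f.toAddMonoidHom.range ⊔ AddSubgroup.map D₂ g.toAddMonoidHom.ker)) := by
  refine ⟨fun y hy => ?_, fun x hx => ⟨?_, fun h => ?_⟩⟩
  · obtain ⟨m, rfl⟩ := QuotientAddGroup.mk'_surjective _ y
    rw [hgbar, QuotientAddGroup.mk'_apply, QuotientAddGroup.eq_zero_iff] at hy
    obtain ⟨u, hu⟩ := hy
    rw [hD₃] at hu
    obtain ⟨B, hB⟩ := exists_mem_graded_sub_eq hz ℳ₂ m
    obtain ⟨h, hh, w, hw⟩ := hB B le_rfl
    have hgh : g h = z • (u + g w) - (u + g w) := by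
      have e := congrArg g hw
      rw [map_sub, map_sub, map_smul, sub_eq_iff_eq_add, ← hu] at e
      rw [e, smul_add]
      abel
    obtain ⟨k, hk⟩ := exists_pow_smul_smul_sub_eq_zero hz ℳ₃ (hgh ▸ hg_deg B h hh)
    obtain ⟨v, hv⟩ := exists_pow_smul_sub_eq z h k
    refine ⟨z ^ k • h, by rw [map_smul, hgh, hk], ?_⟩
    have e : m - z ^ k • h = D₂ (-(w + v)) := by
      rw [map_neg, map_add, hD₂, hD₂, ← hw, ← hv]
      abel
    have e' : QuotientAddGroup.mk' D₂.range (m - z ^ k • h) = 0 := by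
      rw [QuotientAddGroup.mk'_apply, QuotientAddGroup.eq_zero_iff]
      exact ⟨_, e.symm⟩
    rw [← map_sub, e']
    exact zero_mem _
  · rintro ⟨a, ha⟩
    obtain ⟨a, rfl⟩ := QuotientAddGroup.mk'_surjective _ a
    rw [hfbar, QuotientAddGroup.mk'_eq_mk'] at ha
    obtain ⟨_, ⟨b, rfl⟩, rfl⟩ := ha
    refine AddSubgroup.add_mem_sup ⟨a, rfl⟩ ⟨b, ?_, rfl⟩
    rw [map_add, hgf, zero_add, hD₂, map_sub, map_smul] at hx
    exact eq_zero_of_smul_sub_eq_zero hz ℳ₃ hx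
  · obtain ⟨_, ⟨a, rfl⟩, _, ⟨b, _, rfl⟩, rfl⟩ := AddSubgroup.mem_sup.mp h
    refine ⟨QuotientAddGroup.mk' D₁.range a, ?_⟩
    rw [hfbar, QuotientAddGroup.mk'_eq_mk']
    exact ⟨D₂ b, ⟨b, rfl⟩, rfl⟩
end
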